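/- arXiv:2208.00494 — 7 statements merged into one kernel-verified Lean document; each statement's English description precedes it below -/
import Mathlib

section
/- Let M > 0 and let s : ℤ → ℝ satisfy |s(n) + s(n+1) + ⋯ + s(m)| ≤ M for all integers n ≤ m. Define S : ℤ → ℝ by S_0 = 0, S_j = s(1) + ⋯ + s(j) for j ≥ 1, and S_j = −(s(j+1) + ⋯ + s(0)) for j < 0 (so that S_m − S_n = s(n+1) + ⋯ + s(m) whenever n ≤ m). Then for every k ∈ ℤ and every natural number n ≥ 1, e^{−2M} ≤ (e^{S_k} + e^{S_{k+1}} + ⋯ + e^{S_{k+n−1}}) / (e^{S_{k−1}} + e^{S_{k−2}} + ⋯ + e^{S_{k−n}}) ≤ e^{2M}. -/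
theorem shear_telescope (s S : ℤ → ℝ) (hSrec : ∀ j : ℤ, S j = S (j - 1) + s j) (a : ℤ) (n : ℕ) :
    ∑ j ∈ Finset.Icc (a + 1) (a + n), s j = S (a + n) - S a := by
  induction n with
  | zero => simp
  | succ n ih =>
    have h : Finset.Icc (a + 1) (a + ((n + 1 : ℕ) : ℤ))
        = insert (a + ((n + 1 : ℕ) : ℤ)) (Finset.Icc (a + 1) (a + n)) := by
      ext x
      simp only [Finset.mem_Icc, Finset.mem_insert]
      push_cast
      omega
    rw [h, Finset.sum_insert (by simp), ih, hSrec (a + ((n + 1 : ℕ) : ℤ))]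
    have e : a + ((n + 1 : ℕ) : ℤ) - 1 = a + n := by push_cast; ring
    rw [e]
    ring

/-- If all partial sums `s n + ⋯ + s m` are bounded in absolute value by `M`, and
`S` is the cumulative-sum function (`S 0 = 0`, `S j = S (j-1) + s j`), then for all
`k : ℤ` and `n ≥ 1` the ratio
`(e^{S k} + ⋯ + e^{S (k+n-1)}) / (e^{S (k-1)} + ⋯ + e^{S (k-n)})`
lies in `[e^{-2M}, e^{2M}]`. -/
theorem shear_sum_bound_imp_ratio_pinched (M : ℝ) (hM : 0 < M) (s : ℤ → ℝ)
    (hs : ∀ n m : ℤ, n ≤ m → |∑ j ∈ Finset.Icc n m, s j| ≤ M)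
    (S : ℤ → ℝ) (hS0 : S 0 = 0) (hSrec : ∀ j : ℤ, S j = S (j - 1) + s j) :
    ∀ (k : ℤ) (n : ℕ), 1 ≤ n →
      Real.exp (-(2 * M)) ≤
        (∑ i ∈ Finset.range n, Real.exp (S (k + i))) /
          (∑ i ∈ Finset.range n, Real.exp (S (k - 1 - i))) ∧
      (∑ i ∈ Finset.range n, Real.exp (S (k + i))) /
          (∑ i ∈ Finset.range n, Real.exp (S (k - 1 - i))) ≤ Real.exp (2 * M) := by
  intro k n hn
  have key : ∀ i : ℕ, |S (k + i) - S (k - 1 - i)| ≤ M := by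
    intro i
    have h := shear_telescope s S hSrec (k - 1 - i) (2 * i + 1)
    have e : k - 1 - (i : ℤ) + ((2 * i + 1 : ℕ) : ℤ) = k + i := by push_cast; ring
    rw [e] at h
    rw [← h]
    exact hs _ _ (by omega)
  have hpos : 0 < ∑ i ∈ Finset.range n, Real.exp (S (k - 1 - i)) :=
    Finset.sum_pos (fun i _ => Real.exp_pos _) ⟨0, Finset.mem_range.2 hn⟩
  rw [le_div_iff₀ hpos, div_le_iff₀ hpos, Finset.mul_sum, Finset.mul_sum]
  constructor
  · apply Finset.sum_le_sum
    intro i _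
    rw [← Real.exp_add, Real.exp_le_exp]
    linarith [(abs_le.1 (key i)).1]
  · apply Finset.sum_le_sum
    intro i _
    rw [← Real.exp_add, Real.exp_le_exp]
    linarith [(abs_le.1 (key i)).2]
end

section
/- Let x : ℤ → ℝ be a strictly increasing sequence. The following are equivalent: (i) there exists M ≥ 1 such that (x_{j+1} − x_j)/(x_{j'+1} − x_{j'}) ≤ M for all j, j' ∈ ℤ; (ii) there exist t > 0, C ≥ 1, and a sequence d : ℤ → ℝ with d_j > 0 for all j, such that for all j ∈ ℤ: 1/C ≤ √(t/d_j) ≤ C and 1/C ≤ (x_{j+1} − x_j)/√(d_j · d_{j+1}) ≤ C. -/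
/-- For a strictly increasing sequence `x : ℤ → ℝ`, the ratios of consecutive gaps are
uniformly bounded if and only if there is a decoration (a height `t > 0` at infinity and
diameters `d j > 0` at the points `x j`) whose lambda lengths `√(t / d j)` and
`(x (j+1) - x j)/√(d j · d (j+1))` are pinched between `1/C` and `C`. -/
theorem fan_gap_ratio_bounded_iff_pinched_decoration (x : ℤ → ℝ) (hx : StrictMono x) :
    (∃ M : ℝ, 1 ≤ M ∧ ∀ j j' : ℤ, (x (j + 1) - x j) / (x (j' + 1) - x j') ≤ M) ↔
    (∃ t : ℝ, 0 < t ∧ ∃ C : ℝ, 1 ≤ C ∧ ∃ d : ℤ → ℝ, (∀ j : ℤ, 0 < d j) ∧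
      ∀ j : ℤ,
        1 / C ≤ Real.sqrt (t / d j) ∧ Real.sqrt (t / d j) ≤ C ∧
        1 / C ≤ (x (j + 1) - x j) / Real.sqrt (d j * d (j + 1)) ∧
        (x (j + 1) - x j) / Real.sqrt (d j * d (j + 1)) ≤ C) := by
  have hg : ∀ j : ℤ, 0 < x (j + 1) - x j := fun j => sub_pos.2 (hx (by omega))
  constructor
  · rintro ⟨M, hM, h⟩
    have h0 := hg 0
    have hM0 : 0 < M := by linarith
    refine ⟨x (0 + 1) - x 0, h0, M, hM, fun _ => x (0 + 1) - x 0, fun _ => h0, fun j => ?_⟩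
    have e : Real.sqrt ((x (0 + 1) - x 0) / (x (0 + 1) - x 0)) = 1 := by
      rw [div_self h0.ne', Real.sqrt_one]
    have hinv : 1 / M ≤ 1 := by
      rw [div_le_one hM0]; exact hM
    simp only [e, Real.sqrt_mul_self h0.le]
    refine ⟨hinv, hM, ?_, h j 0⟩
    have h1 := h 0 j
    rw [div_le_iff₀ (hg j)] at h1
    rw [div_le_div_iff₀ hM0 h0]
    linarith
  · rintro ⟨t, ht, C, hC, d, hd, h⟩
    have hC0 : 0 < C := by linarith
    have hup : ∀ j, d j ≤ t * C ^ 2 := by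
      intro j
      have h1 := (Real.le_sqrt' (by positivity)).1 (h j).1
      rw [div_pow, one_pow, div_le_div_iff₀ (by positivity) (hd j)] at h1
      linarith
    have hlo : ∀ j, t / C ^ 2 ≤ d j := by
      intro j
      have h1 := (Real.sqrt_le_left hC0.le).1 (h j).2.1
      rw [div_le_iff₀ (hd j)] at h1
      rw [div_le_iff₀ (by positivity)]
      linarith
    have hsu : ∀ j, Real.sqrt (d j * d (j + 1)) ≤ t * C ^ 2 := by
      intro j
      rw [Real.sqrt_le_left (by positivity), sq]
      exact mul_le_mul (hup j) (hup _) (hd _).le (by positivity)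
    have hsl : ∀ j, t / C ^ 2 ≤ Real.sqrt (d j * d (j + 1)) := by
      intro j
      rw [Real.le_sqrt' (by positivity), sq]
      exact mul_le_mul (hlo j) (hlo _) (by positivity) (hd _).le
    have hs : ∀ j, 0 < Real.sqrt (d j * d (j + 1)) := fun j =>
      Real.sqrt_pos.2 (mul_pos (hd _) (hd _))
    refine ⟨C ^ 6, one_le_pow₀ hC, fun j j' => ?_⟩
    have h1 : x (j + 1) - x j ≤ C * (t * C ^ 2) :=
      ((div_le_iff₀ (hs j)).1 (h j).2.2.2).trans (mul_le_mul_of_nonneg_left (hsu j) hC0.le)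
    have h2 : 1 / C * (t / C ^ 2) ≤ x (j' + 1) - x j' :=
      (mul_le_mul_of_nonneg_left (hsl j') (by positivity)).trans
        ((le_div_iff₀ (hs j')).1 (h j').2.2.1)
    rw [div_le_iff₀ (hg j')]
    calc x (j + 1) - x j ≤ C * (t * C ^ 2) := h1
      _ = C ^ 6 * (1 / C * (t / C ^ 2)) := by field_simp
      _ ≤ _ := mul_le_mul_of_nonneg_left h2 (by positivity)
end

section
/- Define h : ℝ → ℝ by: h(x) = x for x ∈ [−1, 1]; for every natural number k and every x ∈ [16^k, 16^{k+1}], h(x) = (15/14)·8^k − 1/14 + 2^{−(k+1)}·(x − 16^k); and h(x) = −h(−x) for x < 0. Then h is quasisymmetric: there exists M ≥ 1 such that for every x ∈ ℝ and every t > 0, 1/M ≤ (h(x+t) − h(x))/(h(x) − h(x−t)) ≤ M. -/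
/-- The lines `L_n(y) = (8^n - 1)/14 + y / 2^n` : the one active at `z` is the lowest. -/
lemma line_le (i j : ℕ) (z : ℝ) (hl : i = 0 ∨ (16 : ℝ) ^ i ≤ 16 * z) (hu : z ≤ 16 ^ i) :
    ((8 : ℝ) ^ i - 1) / 14 + z / 2 ^ i ≤ (8 ^ j - 1) / 14 + z / 2 ^ j := by
  have e8 : ∀ n : ℕ, (8 : ℝ) ^ n = (2 ^ n) ^ 3 := fun n => by
    rw [← pow_mul, mul_comm, pow_mul]; norm_num
  have e16 : ∀ n : ℕ, (16 : ℝ) ^ n = (2 ^ n) ^ 4 := fun n => by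
    rw [← pow_mul, mul_comm, pow_mul]; norm_num
  rw [e8, e8]
  rw [e16] at hl hu
  have two : ∀ m n : ℕ, m < n → 2 * (2 : ℝ) ^ m ≤ 2 ^ n := fun m n hmn => by
    rw [← pow_succ']; exact pow_le_pow_right₀ (by norm_num) hmn
  have hb : (0 : ℝ) < 2 ^ i := by positivity
  have ha : (0 : ℝ) < 2 ^ j := by positivity
  have key : ((2 ^ j : ℝ) ^ 3 - 1) / 14 + z / 2 ^ j - (((2 ^ i) ^ 3 - 1) / 14 + z / 2 ^ i)
      = ((2 ^ i : ℝ) - 2 ^ j) * (z - (2 ^ i * 2 ^ j) * ((2 ^ i) ^ 2 + 2 ^ i * 2 ^ j + (2 ^ j) ^ 2) / 14)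
        / (2 ^ i * 2 ^ j) := by
    field_simp
    ring
  have : 0 ≤ ((2 ^ i : ℝ) - 2 ^ j) *
      (z - (2 ^ i * 2 ^ j) * ((2 ^ i) ^ 2 + 2 ^ i * 2 ^ j + (2 ^ j) ^ 2) / 14) := by
    rcases lt_trichotomy i j with hij | hij | hij
    · have h2 := two i j hij
      generalize (2 : ℝ) ^ i = b at *
      generalize (2 : ℝ) ^ j = a at *
      apply mul_nonneg_of_nonpos_of_nonpos (by linarith)
      have q1 : b * (2 * b) ≤ b * a := by gcongr
      have q2 : b ^ 2 + b * (2 * b) + (2 * b) ^ 2 ≤ b ^ 2 + b * a + a ^ 2 := by gcongr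
      have q3 := mul_le_mul q1 q2 (by positivity) (by positivity)
      nlinarith
    · subst hij; simp
    · have h2 := two j i hij
      have hl' := hl.resolve_left (by omega)
      generalize (2 : ℝ) ^ i = b at *
      generalize (2 : ℝ) ^ j = a at *
      apply mul_nonneg (by linarith)
      have h2' : a ≤ b / 2 := by linarith
      have q1 : b * a ≤ b * (b / 2) := by gcongr
      have q2 : b ^ 2 + b * a + a ^ 2 ≤ b ^ 2 + b * (b / 2) + (b / 2) ^ 2 := by gcongr
      have q3 := mul_le_mul q1 q2 (by positivity) (by positivity)
      nlinarith
  have := div_nonneg this (mul_pos hb ha).le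
  linarith

/-- The piecewise-linear map `h` of Example 2.6 (identity on `[-1,1]`, slope
`2^{-(k+1)}` on `[16^k, 16^{k+1}]`, and odd) is quasisymmetric. -/
theorem h_quasisymmetric (h : ℝ → ℝ)
    (h1 : ∀ x : ℝ, -1 ≤ x → x ≤ 1 → h x = x)
    (h2 : ∀ k : ℕ, ∀ x : ℝ, (16 : ℝ) ^ k ≤ x → x ≤ (16 : ℝ) ^ (k + 1) →
      h x = 15 / 14 * 8 ^ k - 1 / 14 + (x - 16 ^ k) / 2 ^ (k + 1))
    (h3 : ∀ x : ℝ, x < 0 → h x = -h (-x)) :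
    ∃ M : ℝ, 1 ≤ M ∧ ∀ x t : ℝ, 0 < t →
      1 / M ≤ (h (x + t) - h x) / (h x - h (x - t)) ∧
      (h (x + t) - h x) / (h x - h (x - t)) ≤ M := by
  have hn : ∀ y : ℝ, ∃ n : ℕ, 0 ≤ y → (n = 0 ∨ (16 : ℝ) ^ n ≤ 16 * y) ∧ y ≤ 16 ^ n ∧
      h y = ((8 : ℝ) ^ n - 1) / 14 + y / 2 ^ n := by
    intro y
    by_cases hy1 : y ≤ 1
    · refine ⟨0, fun hy => ⟨Or.inl rfl, by simpa using hy1, ?_⟩⟩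
      rw [h1 y (by linarith) hy1]; simp
    · obtain ⟨k, hk1, hk2⟩ := exists_nat_pow_near (le_of_not_ge hy1) (by norm_num : (1 : ℝ) < 16)
      refine ⟨k + 1, fun _ => ⟨Or.inr ?_, hk2.le, ?_⟩⟩
      · rw [pow_succ']; linarith
      · rw [h2 k y hk1 hk2.le]
        have e : (16 : ℝ) ^ k = 8 ^ k * 2 ^ k := by rw [← mul_pow]; norm_num
        rw [e, pow_succ, pow_succ]
        field_simp
        ring
  choose n hn using hn
  obtain ⟨s, hs⟩ : ∃ s : ℝ → ℝ, ∀ y, s y = 1 / 2 ^ n y := ⟨_, fun _ => rfl⟩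
  have spos : ∀ y, 0 < s y := fun y => by rw [hs]; positivity
  have T : ∀ y z : ℝ, 0 ≤ y → 0 ≤ z → h z ≤ h y + s y * (z - y) := by
    intro y z hy hz
    obtain ⟨a1, a2, a3⟩ := hn z hz
    obtain ⟨-, -, b3⟩ := hn y hy
    have := line_le (n z) (n y) z a1 a2
    rw [a3, b3, hs]
    refine this.trans (le_of_eq ?_)
    ring
  have anti : ∀ y z : ℝ, 0 ≤ y → y ≤ z → s z ≤ s y := by
    intro y z hy hyz
    rcases hyz.eq_or_lt with rfl | hlt
    · exact le_rfl
    have t1 := T y z hy (hy.trans hyz)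
    have t2 := T z y (hy.trans hyz) hy
    by_contra hc
    push Not at hc
    nlinarith [mul_pos (sub_pos.2 hc) (sub_pos.2 hlt)]
  have s3 : ∀ y : ℝ, 0 ≤ y → s y ≤ 2 * s (3 * y) := by
    intro y hy
    obtain ⟨a1, -, -⟩ := hn (3 * y) (by linarith)
    obtain ⟨-, b2, -⟩ := hn y hy
    have hle : n (3 * y) ≤ n y + 1 := by
      rcases a1 with a1 | a1
      · omega
      · by_contra hc
        have : (16 : ℝ) ^ (n y + 2) ≤ 16 ^ n (3 * y) :=
          pow_le_pow_right₀ (by norm_num) (by omega)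
        rw [pow_add] at this
        have : (0 : ℝ) < 16 ^ n y := by positivity
        linarith
    have hp : (2 : ℝ) ^ n (3 * y) ≤ 2 ^ (n y + 1) := pow_le_pow_right₀ (by norm_num) hle
    have := one_div_le_one_div_of_le (by positivity) hp
    rw [hs, hs]
    have e : (1 : ℝ) / 2 ^ (n y + 1) = 1 / 2 ^ n y / 2 := by rw [pow_succ]; field_simp
    linarith
  have hC : ∀ y : ℝ, 0 ≤ y → h y ≤ 4 * (y * s y) := by
    intro y hy
    obtain ⟨a1, -, a3⟩ := hn y hy
    rw [a3, hs]
    have hyp : 0 ≤ y / 2 ^ n y := by positivity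
    have e0 : y * (1 / 2 ^ n y) = y / 2 ^ n y := by ring
    rw [e0]
    rcases a1 with a1 | a1
    · rw [a1] at hyp ⊢; norm_num at hyp ⊢; linarith
    · have e : (8 : ℝ) ^ n y = 16 ^ n y / 2 ^ n y := by rw [← div_pow]; norm_num
      have : (8 : ℝ) ^ n y ≤ 16 * (y / 2 ^ n y) := by
        rw [e, ← mul_div_assoc]; gcongr
      linarith
  have h0 : h 0 = 0 := h1 0 (by norm_num) (by norm_num)
  have smono : ∀ y z : ℝ, 0 ≤ y → y < z → h y < h z := by
    intro y z hy hyz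
    have := T z y (hy.trans hyz.le) hy
    nlinarith [mul_pos (spos z) (sub_pos.2 hyz)]
  have mono : ∀ y z : ℝ, 0 ≤ y → y ≤ z → h y ≤ h z := by
    intro y z hy hyz
    rcases hyz.eq_or_lt with rfl | hlt
    · exact le_rfl
    · exact (smono y z hy hlt).le
  have nonneg : ∀ y : ℝ, 0 ≤ y → 0 ≤ h y := fun y hy => h0 ▸ mono 0 y le_rfl hy
  have odd : ∀ y : ℝ, h (-y) = -h y := by
    intro y
    rcases lt_trichotomy y 0 with hy | rfl | hy
    · rw [h3 y hy]; ring
    · simp [h0]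
    · rw [h3 (-y) (by linarith), neg_neg]
  have dbl : ∀ y : ℝ, 0 ≤ y → h (2 * y) ≤ 2 * h y := by
    intro y hy
    have t1 := T y (2 * y) hy (by linarith)
    have t2 := T y 0 hy le_rfl
    rw [h0] at t2
    linarith
  have core : ∀ x t : ℝ, 0 ≤ x → 0 < t → 0 < h (x + t) - h x ∧ 0 < h x - h (x - t) ∧
      h (x + t) - h x ≤ 24 * (h x - h (x - t)) ∧ h x - h (x - t) ≤ 24 * (h (x + t) - h x) := by
    intro x t hx ht
    have hA : 0 < h (x + t) - h x := sub_pos.2 (smono _ _ hx (by linarith))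
    have tA := T (x + t) x (by linarith) hx
    have tA' : t * s (x + t) ≤ h (x + t) - h x := by linarith
    have low : x < 2 * t → h x - h (x - t) ≤ 3 * h t →
        h x - h (x - t) ≤ 24 * (h (x + t) - h x) := by
      intro hxt hB
      have c1 := hC t ht.le
      have c2 := s3 t ht.le
      have c3 := anti (x + t) (3 * t) (by linarith) (by linarith)
      have : t * s t ≤ t * (2 * s (x + t)) := by gcongr; linarith
      linarith
    have h2t : x < 2 * t → h x ≤ 2 * h t := fun hxt =>
      (mono x (2 * t) hx hxt.le).trans (dbl t ht.le)
    rcases le_or_gt t x with htx | htx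
    · have hB : 0 < h x - h (x - t) := sub_pos.2 (smono _ _ (by linarith) (by linarith))
      refine ⟨hA, hB, ?_, ?_⟩
      · have t1 := T x (x + t) hx (by linarith)
        have t2 := T x (x - t) hx (by linarith)
        linarith
      · rcases le_or_gt (2 * t) x with h2 | h2
        · have t1 := T (x - t) x (by linarith) hx
          have c2 := s3 (x - t) (by linarith)
          have c3 := anti (x + t) (3 * (x - t)) (by linarith) (by linarith)
          have : t * s (x - t) ≤ t * (2 * s (x + t)) := by gcongr; linarith
          linarith
        · have := nonneg (x - t) (by linarith)
          have := nonneg t ht.le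
          exact low h2 (by linarith [h2t h2])
    · have e : h (x - t) = - h (t - x) := by rw [← odd]; congr 1; ring
      have p1 := nonneg x hx
      have p2 := smono 0 (t - x) le_rfl (by linarith)
      rw [h0] at p2
      refine ⟨hA, by linarith, ?_, ?_⟩
      · have q1 := mono (x + t) (2 * t) (by linarith) (by linarith)
        have q2 := dbl t ht.le
        have q3 := dbl (t / 2) (by linarith)
        rw [mul_div_cancel₀ t (by norm_num : (2 : ℝ) ≠ 0)] at q3
        rcases le_total (t / 2) x with q | q
        · have := mono (t / 2) x (by linarith) q
          linarith
        · have := mono (t / 2) (t - x) (by linarith) (by linarith)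
          linarith
      · have := mono (t - x) t (by linarith) (by linarith)
        exact low (by linarith) (by linarith [h2t (by linarith)])
  have fin : ∀ a b : ℝ, 0 < a → 0 < b → a ≤ 24 * b → b ≤ 24 * a →
      1 / 24 ≤ a / b ∧ a / b ≤ 24 := by
    intro a b ha hb hab hba
    constructor
    · rw [le_div_iff₀ hb]; linarith
    · rw [div_le_iff₀ hb]; exact hab
  refine ⟨24, by norm_num, fun x t ht => ?_⟩
  rcases le_total 0 x with hx | hx
  · obtain ⟨c1, c2, c3, c4⟩ := core x t hx ht
    exact fin _ _ c1 c2 c3 c4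
  · obtain ⟨c1, c2, c3, c4⟩ := core (-x) t (by linarith) ht
    have e1 : h (-x + t) = - h (x - t) := by rw [← odd]; congr 1; ring
    have e2 : h (-x - t) = - h (x + t) := by rw [← odd]; congr 1; ring
    have e3 := odd x
    apply fin <;> linarith
end

section
/- Define h : ℝ → ℝ by: h(x) = x for x ∈ [−1, 1]; for every natural number k and every x ∈ [16^k, 16^{k+1}], h(x) = (15/14)·8^k − 1/14 + 2^{−(k+1)}·(x − 16^k); and h(x) = −h(−x) for x < 0. Let k, l be natural numbers with 1 ≤ l ≤ k − 1, let t > 0 and x ∈ ℝ satisfy 16^k ≤ x + t < 16^{k+1} and 16^{l−1} ≤ x < 16^l. Then 7/128 ≤ (h(x+t) − h(x))/(h(x) − h(x−t)) ≤ 64. -/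
theorem case1_aux (j : ℕ) (x : ℝ) (a : (16 : ℝ) ^ j ≤ x) (b : x ≤ (16 : ℝ) ^ (j + 1)) :
    0 ≤ (x - 16 ^ j) / 2 ^ (j + 1) ∧ (x - 16 ^ j) / 2 ^ (j + 1) ≤ 15 / 2 * (8 : ℝ) ^ j := by
  have e : (16 : ℝ) ^ j = 8 ^ j * 2 ^ j := by rw [← mul_pow]; norm_num
  have p : (0 : ℝ) < 2 ^ (j + 1) := by positivity
  constructor
  · exact div_nonneg (by linarith) p.le
  · rw [div_le_iff₀ p]
    rw [pow_succ] at b ⊢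
    nlinarith

/-- Case 1 of the quasisymmetry estimate in Example 2.6: for the piecewise-linear
map `h`, if `16^k ≤ x + t < 16^{k+1}` and `16^{l-1} ≤ x < 16^l` with `1 ≤ l ≤ k - 1`,
then `7/128 ≤ (h(x+t) - h(x))/(h(x) - h(x-t)) ≤ 64`. -/
theorem case1_ratio_bound (h : ℝ → ℝ)
    (h1 : ∀ x : ℝ, -1 ≤ x → x ≤ 1 → h x = x)
    (h2 : ∀ k : ℕ, ∀ x : ℝ, (16 : ℝ) ^ k ≤ x → x ≤ (16 : ℝ) ^ (k + 1) →
      h x = 15 / 14 * 8 ^ k - 1 / 14 + (x - 16 ^ k) / 2 ^ (k + 1))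
    (h3 : ∀ x : ℝ, x < 0 → h x = -h (-x))
    (k l : ℕ) (hl : 1 ≤ l) (hlk : l + 1 ≤ k)
    (t x : ℝ) (ht : 0 < t)
    (hxt1 : (16 : ℝ) ^ k ≤ x + t) (hxt2 : x + t < (16 : ℝ) ^ (k + 1))
    (hx1 : (16 : ℝ) ^ (l - 1) ≤ x) (hx2 : x < (16 : ℝ) ^ l) :
    7 / 128 ≤ (h (x + t) - h x) / (h x - h (x - t)) ∧
      (h (x + t) - h x) / (h x - h (x - t)) ≤ 64 := by
  obtain ⟨m, rfl⟩ : ∃ m, k = m + 1 := ⟨k - 1, by omega⟩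
  obtain ⟨n, rfl⟩ : ∃ n, l = n + 1 := ⟨l - 1, by omega⟩
  have hnm : n + 1 ≤ m := by omega
  simp only [Nat.add_sub_cancel] at hx1
  have hA : (1 : ℝ) ≤ 8 ^ m := one_le_pow₀ (by norm_num)
  have hn1 : (1 : ℝ) ≤ 8 ^ n := one_le_pow₀ (by norm_num)
  have hnA : (8 : ℝ) ^ (n + 1) ≤ 8 ^ m := pow_le_pow_right₀ (by norm_num) hnm
  have hnB : (16 : ℝ) ^ (n + 1) ≤ 16 ^ m := pow_le_pow_right₀ (by norm_num) hnm
  have hB : (1 : ℝ) ≤ 16 ^ m := one_le_pow₀ (by norm_num)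
  have hn16 : (1 : ℝ) ≤ 16 ^ n := one_le_pow₀ (by norm_num)
  have ex := h2 n x hx1 hx2.le
  obtain ⟨x1, x2⟩ := case1_aux n x hx1 hx2.le
  have eu := h2 (m + 1) (x + t) hxt1 hxt2.le
  obtain ⟨u1, u2⟩ := case1_aux (m + 1) (x + t) hxt1 hxt2.le
  have s8 : (8 : ℝ) ^ (m + 1) = 8 * 8 ^ m := by ring
  have s8n : (8 : ℝ) ^ (n + 1) = 8 * 8 ^ n := by ring
  have s16 : (16 : ℝ) ^ (m + 1) = 16 * 16 ^ m := by ring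
  have s16' : (16 : ℝ) ^ (m + 1 + 1) = 256 * 16 ^ m := by ring
  have ey := h3 (x - t) (by linarith)
  have e : (16 : ℝ) ^ m = 8 ^ m * 2 ^ m := by rw [← mul_pow]; norm_num
  have hy : 15 / 14 * 8 ^ m - 1 / 14 + 13 / 2 * 8 ^ m ≤ h (-(x - t)) ∧
      h (-(x - t)) ≤ 15 / 14 * (64 * 8 ^ m) - 1 / 14 := by
    rcases le_total (-(x - t)) ((16 : ℝ) ^ (m + 1)) with c | c
    · have c' : (16 : ℝ) ^ m ≤ -(x - t) := by linarith
      have ez := h2 m _ c' c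
      obtain ⟨z1, z2⟩ := case1_aux m _ c' c
      have : 13 / 2 * (8 : ℝ) ^ m ≤ (-(x - t) - 16 ^ m) / 2 ^ (m + 1) := by
        rw [le_div_iff₀ (by positivity)]
        have : 13 / 2 * (8 : ℝ) ^ m * 2 ^ (m + 1) = 13 * 16 ^ m := by rw [e]; ring
        linarith
      constructor <;> linarith
    · have c' : -(x - t) ≤ (16 : ℝ) ^ (m + 1 + 1) := by linarith
      have ez := h2 (m + 1) _ c c'
      obtain ⟨z1, z2⟩ := case1_aux (m + 1) _ c c'
      constructor <;> linarith
  obtain ⟨y1, y2⟩ := hy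
  have hD : 0 < h x - h (x - t) := by linarith
  rw [le_div_iff₀ hD, div_le_iff₀ hD]
  constructor <;> linarith
end

section
/- Define h : ℝ → ℝ by: h(x) = x for x ∈ [−1, 1]; for every natural number k and every x ∈ [16^k, 16^{k+1}], h(x) = (15/14)·8^k − 1/14 + 2^{−(k+1)}·(x − 16^k); and h(x) = −h(−x) for x < 0. Let k ≥ 2 be a natural number, t > 0, and x ∈ ℝ satisfy 16^{k−1} ≤ x ≤ 16^k ≤ x + t ≤ 16^{k+1} and x − t ≥ 16^{k−2}. Then 1/4 ≤ (h(x+t) − h(x))/(h(x) − h(x−t)) ≤ 4. -/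
/-- First subcase of Case 3 of the quasisymmetry estimate in Example 2.6: for the
piecewise-linear map `h`, if `16^{k-1} ≤ x ≤ 16^k ≤ x + t ≤ 16^{k+1}` with `k ≥ 2`
and `x - t ≥ 16^{k-2}`, then `1/4 ≤ (h(x+t) - h(x))/(h(x) - h(x-t)) ≤ 4`. -/
theorem case3a_ratio_bound (h : ℝ → ℝ)
    (h1 : ∀ x : ℝ, -1 ≤ x → x ≤ 1 → h x = x)
    (h2 : ∀ k : ℕ, ∀ x : ℝ, (16 : ℝ) ^ k ≤ x → x ≤ (16 : ℝ) ^ (k + 1) →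
      h x = 15 / 14 * 8 ^ k - 1 / 14 + (x - 16 ^ k) / 2 ^ (k + 1))
    (h3 : ∀ x : ℝ, x < 0 → h x = -h (-x))
    (k : ℕ) (hk : 2 ≤ k) (t x : ℝ) (ht : 0 < t)
    (hx1 : (16 : ℝ) ^ (k - 1) ≤ x) (hx2 : x ≤ (16 : ℝ) ^ k)
    (hx3 : (16 : ℝ) ^ k ≤ x + t) (hx4 : x + t ≤ (16 : ℝ) ^ (k + 1))
    (hx5 : (16 : ℝ) ^ (k - 2) ≤ x - t) :
    1 / 4 ≤ (h (x + t) - h x) / (h x - h (x - t)) ∧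
      (h (x + t) - h x) / (h x - h (x - t)) ≤ 4 := by
  obtain ⟨m, rfl⟩ : ∃ m, k = m + 2 := ⟨k - 2, by omega⟩
  have e1 : m + 2 - 1 = m + 1 := by omega
  have e2 : m + 2 - 2 = m := by omega
  rw [e1] at hx1
  rw [e2] at hx5
  have hp : (0 : ℝ) < 2 ^ m := by positivity
  have hA : (16 : ℝ) ^ m = 8 ^ m * 2 ^ m := by rw [← mul_pow]; norm_num
  -- rescale everything by `s = 1 / (8 * 2 ^ m)`
  obtain ⟨s, hs⟩ : ∃ s : ℝ, s = 1 / (8 * 2 ^ m) := ⟨_, rfl⟩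
  have hs0 : 0 < s := by rw [hs]; positivity
  have hB : (8 : ℝ) ^ m = 8 * (16 ^ m * s) := by
    rw [hA, hs]; field_simp
  have F0 : ∀ y : ℝ, 16 ^ m ≤ y → y ≤ 16 * 16 ^ m →
      h y = 60 / 7 * (16 ^ m * s) - 1 / 14 + 4 * (y * s - 16 ^ m * s) := by
    intro y a b
    rw [h2 m y a (by rw [pow_succ]; linarith), hB, hs, pow_succ]
    field_simp
    ring
  have F1 : ∀ y : ℝ, 16 * 16 ^ m ≤ y → y ≤ 256 * 16 ^ m →
      h y = 480 / 7 * (16 ^ m * s) - 1 / 14 + 2 * (y * s - 16 * (16 ^ m * s)) := by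
    intro y a b
    rw [h2 (m + 1) y (by rw [pow_succ]; linarith) (by rw [pow_succ, pow_succ]; linarith),
      pow_succ 8 m, hB, hs, pow_succ, pow_succ, pow_succ]
    field_simp
    ring
  have F2 : ∀ y : ℝ, 256 * 16 ^ m ≤ y → y ≤ 4096 * 16 ^ m →
      h y = 3840 / 7 * (16 ^ m * s) - 1 / 14 + (y * s - 256 * (16 ^ m * s)) := by
    intro y a b
    rw [h2 (m + 2) y (by rw [pow_succ, pow_succ]; linarith)
      (by rw [pow_succ, pow_succ, pow_succ]; linarith),
      pow_succ 8 (m + 1), pow_succ 8 m, hB, hs, pow_succ, pow_succ, pow_succ, pow_succ, pow_succ]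
    field_simp
    ring
  have p1 : (16 : ℝ) ^ (m + 1) = 16 * 16 ^ m := by ring
  have p2 : (16 : ℝ) ^ (m + 2) = 256 * 16 ^ m := by ring
  have p3 : (16 : ℝ) ^ (m + 2 + 1) = 4096 * 16 ^ m := by ring
  rw [p1] at hx1
  rw [p2] at hx2 hx3
  rw [p3] at hx4
  have T0 := mul_pos ht hs0
  have m1 := mul_le_mul_of_nonneg_right hx1 hs0.le
  have m2 := mul_le_mul_of_nonneg_right hx2 hs0.le
  have m3 := mul_le_mul_of_nonneg_right hx3 hs0.le
  have m5 := mul_le_mul_of_nonneg_right hx5 hs0.le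
  have G2 := F2 _ hx3 hx4
  have G1 := F1 _ hx1 hx2
  have key : 2 * (t * s) ≤ h x - h (x - t) ∧ h x - h (x - t) ≤ 4 * (t * s) := by
    rcases le_total (x - t) (16 * 16 ^ m) with c | c
    · have G0 := F0 _ hx5 c
      have m6 := mul_le_mul_of_nonneg_right c hs0.le
      constructor <;> linarith
    · have G0 := F1 _ c (by linarith)
      constructor <;> linarith
  have key2 : t * s ≤ h (x + t) - h x ∧ h (x + t) - h x ≤ 2 * (t * s) := by
    constructor <;> linarith
  have hd : 0 < h x - h (x - t) := by linarith [key.1]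
  rw [le_div_iff₀ hd, div_le_iff₀ hd]
  constructor <;> linarith [key.1, key.2, key2.1, key2.2]
end

section
/- Define h : ℝ → ℝ by: h(x) = x for x ∈ [−1, 1]; for every natural number k and every x ∈ [16^k, 16^{k+1}], h(x) = (15/14)·8^k − 1/14 + 2^{−(k+1)}·(x − 16^k); and h(x) = −h(−x) for x < 0. Let k ≥ 2 be a natural number, t > 0, and x ∈ ℝ satisfy 16^{k−1} ≤ x ≤ 16^k ≤ x + t ≤ 16^{k+1} and x − t < 16^{k−2}. Then (h(x+t) − h(x))/(h(x) − h(x−t)) ≤ 8³. -/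
theorem aux_ends (k : ℕ) (x : ℝ) (a : (16 : ℝ) ^ k ≤ x) (b : x ≤ (16 : ℝ) ^ (k + 1)) :
    0 ≤ (x - 16 ^ k) / 2 ^ (k + 1) ∧ (x - 16 ^ k) / 2 ^ (k + 1) ≤ 15 / 2 * (8 : ℝ) ^ k := by
  have hp : (0 : ℝ) < 2 ^ (k + 1) := by positivity
  have he : (16 : ℝ) ^ k = 8 ^ k * 2 ^ k := by rw [← mul_pow]; norm_num
  refine ⟨div_nonneg (by linarith) hp.le, ?_⟩
  rw [div_le_iff₀ hp]
  have : 15 / 2 * (8 : ℝ) ^ k * 2 ^ (k + 1) = 15 * 16 ^ k := by rw [he, pow_succ]; ring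
  rw [this]
  rw [pow_succ] at b
  linarith


/-- Upper bound in the second subcase of Case 3 of the quasisymmetry estimate in
Example 2.6: for the piecewise-linear map `h`, if `16^{k-1} ≤ x ≤ 16^k ≤ x + t ≤ 16^{k+1}`
with `k ≥ 2` and `x - t < 16^{k-2}`, then `(h(x+t) - h(x))/(h(x) - h(x-t)) ≤ 8³`. -/
theorem case3b_upper_bound (h : ℝ → ℝ)
    (h1 : ∀ x : ℝ, -1 ≤ x → x ≤ 1 → h x = x)
    (h2 : ∀ k : ℕ, ∀ x : ℝ, (16 : ℝ) ^ k ≤ x → x ≤ (16 : ℝ) ^ (k + 1) →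
      h x = 15 / 14 * 8 ^ k - 1 / 14 + (x - 16 ^ k) / 2 ^ (k + 1))
    (h3 : ∀ x : ℝ, x < 0 → h x = -h (-x))
    (k : ℕ) (hk : 2 ≤ k) (t x : ℝ) (ht : 0 < t)
    (hx1 : (16 : ℝ) ^ (k - 1) ≤ x) (hx2 : x ≤ (16 : ℝ) ^ k)
    (hx3 : (16 : ℝ) ^ k ≤ x + t) (hx4 : x + t ≤ (16 : ℝ) ^ (k + 1))
    (hx5 : x - t < (16 : ℝ) ^ (k - 2)) :
    (h (x + t) - h x) / (h x - h (x - t)) ≤ 8 ^ 3 := by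
  obtain ⟨m, rfl⟩ : ∃ m, k = m + 2 := ⟨k - 2, by omega⟩
  have e1 : m + 2 - 1 = m + 1 := by omega
  have e2 : m + 2 - 2 = m := by omega
  rw [e1] at hx1
  rw [e2] at hx5
  have one : ∀ n : ℕ, (1 : ℝ) ≤ 8 ^ n := fun n => one_le_pow₀ (by norm_num)
  have key : h (x - t) ≤ 15 / 14 * 8 ^ m - 1 / 14 := by
    generalize x - t = y at hx5
    have hm := one m
    rcases lt_or_ge y 0 with hy | hy
    · rw [h3 y hy]
      have : 0 ≤ h (-y) := by
        rcases le_total (-y) 1 with hz | hz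
        · rw [h1 _ (by linarith) hz]; linarith
        · obtain ⟨n, a, b⟩ := exists_nat_pow_near hz (by norm_num : (1 : ℝ) < 16)
          rw [h2 n _ a b.le]
          have := (aux_ends n _ a b.le).1
          have := one n
          linarith
      linarith
    · rcases le_total y 1 with hz | hz
      · rw [h1 _ (by linarith) hz]; linarith
      · obtain ⟨n, a, b⟩ := exists_nat_pow_near hz (by norm_num : (1 : ℝ) < 16)
        rw [h2 n _ a b.le]
        have h5 := (aux_ends n _ a b.le).2
        have hn : n < m := (pow_lt_pow_iff_right₀ (by norm_num : (1 : ℝ) < 16)).1 (a.trans_lt hx5)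
        have h6 : (8 : ℝ) ^ (n + 1) ≤ 8 ^ m := pow_le_pow_right₀ (by norm_num) hn
        rw [pow_succ] at h6
        linarith
  have hA := (aux_ends _ _ hx1 hx2).1
  have hB := (aux_ends _ _ hx3 hx4).2
  rw [h2 _ _ hx3 hx4, h2 _ _ hx1 hx2]
  have p1 : (8 : ℝ) ^ (m + 1) = 8 * 8 ^ m := by ring
  have p2 : (8 : ℝ) ^ (m + 2) = 64 * 8 ^ m := by ring
  have hm := one m
  rw [p2] at hB
  rw [p1, p2]
  rw [div_le_iff₀ (by linarith)]
  linarith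
end

section
/- Define h : ℝ → ℝ by: h(x) = x for x ∈ [−1, 1]; for every natural number k and every x ∈ [16^k, 16^{k+1}], h(x) = (15/14)·8^k − 1/14 + 2^{−(k+1)}·(x − 16^k); and h(x) = −h(−x) for x < 0. Let k, l be natural numbers with l + 2 ≤ k − 1, let t > 0 and x ∈ ℝ satisfy 16^l ≤ x − t ≤ 16^{l+1} and 16^{k−1} ≤ x ≤ 16^k. Then h(x) − h(x − t) ≤ (15/14)·(8^k − 8^l) ≤ (16²/14)·t/2^k. -/
/-- Key upper estimate in the second subcase of Case 3 of Example 2.6: for the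
piecewise-linear map `h`, if `16^l ≤ x - t ≤ 16^{l+1}` and `16^{k-1} ≤ x ≤ 16^k`
with `l + 2 ≤ k - 1`, then
`h(x) - h(x-t) ≤ (15/14)(8^k - 8^l) ≤ (16²/14)·t/2^k`. -/
theorem case3b_key_estimate (h : ℝ → ℝ)
    (h1 : ∀ x : ℝ, -1 ≤ x → x ≤ 1 → h x = x)
    (h2 : ∀ k : ℕ, ∀ x : ℝ, (16 : ℝ) ^ k ≤ x → x ≤ (16 : ℝ) ^ (k + 1) →
      h x = 15 / 14 * 8 ^ k - 1 / 14 + (x - 16 ^ k) / 2 ^ (k + 1))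
    (h3 : ∀ x : ℝ, x < 0 → h x = -h (-x))
    (k l : ℕ) (hlk : l + 3 ≤ k) (t x : ℝ) (ht : 0 < t)
    (hxt1 : (16 : ℝ) ^ l ≤ x - t) (hxt2 : x - t ≤ (16 : ℝ) ^ (l + 1))
    (hx1 : (16 : ℝ) ^ (k - 1) ≤ x) (hx2 : x ≤ (16 : ℝ) ^ k) :
    h x - h (x - t) ≤ 15 / 14 * ((8 : ℝ) ^ k - 8 ^ l) ∧
      15 / 14 * ((8 : ℝ) ^ k - 8 ^ l) ≤ 16 ^ 2 / 14 * t / 2 ^ k := by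
  obtain ⟨m, rfl⟩ : ∃ m, k = m + 1 := ⟨k - 1, by omega⟩
  simp only [Nat.add_sub_cancel] at hx1
  have e : (16 : ℝ) ^ m = 8 ^ m * 2 ^ m := by rw [← mul_pow]; norm_num
  have p2 : (0 : ℝ) < 2 ^ m := by positivity
  constructor
  · rw [h2 m x hx1 hx2, h2 l (x - t) hxt1 hxt2]
    have a : 0 ≤ (x - t - 16 ^ l) / (2 : ℝ) ^ (l + 1) :=
      div_nonneg (by linarith) (by positivity)
    have b : (x - 16 ^ m) / (2 : ℝ) ^ (m + 1) ≤ 15 / 2 * 8 ^ m := by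
      rw [div_le_iff₀ (by positivity)]
      rw [pow_succ] at hx2 ⊢
      nlinarith
    rw [pow_succ (8 : ℝ) m]
    linarith
  · have c : (16 : ℝ) ^ (l + 1) * 16 ≤ 16 ^ m := by
      rw [← pow_succ]
      exact pow_le_pow_right₀ (by norm_num) (by omega)
    have d : 15 / 16 * (8 ^ m * 2 ^ m) ≤ t := by rw [← e]; linarith
    have f : (0 : ℝ) < 8 ^ l := by positivity
    have g : 15 / 14 * (8 : ℝ) ^ (m + 1) ≤ 16 ^ 2 / 14 * t / 2 ^ (m + 1) := by
      rw [le_div_iff₀ (by positivity), pow_succ, pow_succ]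
      nlinarith
    linarith
end
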